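/- arXiv:2309.05611 — 5 statements merged into one kernel-verified Lean document; each statement's English description precedes it below -/
import Mathlib

section
/- Let k ≥ 2 and m₁,…,m_k ≥ 1. The orbit space (S^{m₁} × S^{m₂} × ⋯ × S^{m_k})/G_k of the product of unit spheres by the group G_k of orientation-preserving sign-changes is homeomorphic to the sphere S^m, where m = m₁ + ⋯ + m_k. -/
open scoped BigOperators

noncomputable section

/-- The orbit relation of the group `G_k` of orientation-preserving sign changes acting
componentwise on a product of unit spheres `S^{m 0} × ⋯ × S^{m (k-1)}`: the `i`-th sign
`ε i ∈ {±1}` flips the last coordinate of the `i`-th sphere factor, and membership in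
`G_k ⊂ ℤ₂^k` means the product of the signs equals `1` (an even number of flips). -/
def signRel (k : ℕ) (m : Fin k → ℕ)
    (a b : ∀ i : Fin k, {y : EuclideanSpace ℝ (Fin (m i + 1)) // ‖y‖ = 1}) : Prop :=
  ∃ ε : Fin k → ℝ, (∀ i, ε i = 1 ∨ ε i = -1) ∧ (∏ i, ε i) = 1 ∧
    ∀ i : Fin k, ∀ j : Fin (m i + 1),
      (b i).1 j = if j = Fin.last (m i) then ε i * (a i).1 j else (a i).1 j

/-- Coordinates on the orbit space of sign changes: all the non-last coordinates of the factors,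
followed by the product of the last coordinates. -/
def signCoord (k : ℕ) (m : Fin k → ℕ) (a : ∀ i, EuclideanSpace ℝ (Fin (m i + 1))) :
    EuclideanSpace ℝ (Fin ((∑ i, m i) + 1)) :=
  WithLp.toLp 2 (Fin.snoc (α := fun _ => ℝ)
    (fun p => a (finSigmaFinEquiv.symm p).1 (Fin.castSucc (finSigmaFinEquiv.symm p).2))
    (∏ i, a i (Fin.last (m i))))

lemma signCoord_castSucc {k : ℕ} {m : Fin k → ℕ} (a : ∀ i, EuclideanSpace ℝ (Fin (m i + 1)))
    (i : Fin k) (j : Fin (m i)) :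
    signCoord k m a (Fin.castSucc (finSigmaFinEquiv ⟨i, j⟩)) = a i (Fin.castSucc j) := by
  simp only [signCoord, Fin.snoc_castSucc]
  rw [Equiv.symm_apply_apply]

lemma signCoord_last {k : ℕ} {m : Fin k → ℕ} (a : ∀ i, EuclideanSpace ℝ (Fin (m i + 1))) :
    signCoord k m a (Fin.last _) = ∏ i, a i (Fin.last (m i)) := by
  simp [signCoord]

lemma eq_of_signCoord_indices {k : ℕ} {m : Fin k → ℕ}
    {v w : EuclideanSpace ℝ (Fin ((∑ i, m i) + 1))}
    (h : ∀ i (j : Fin (m i)), v (Fin.castSucc (finSigmaFinEquiv ⟨i, j⟩)) =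
      w (Fin.castSucc (finSigmaFinEquiv ⟨i, j⟩)))
    (hl : v (Fin.last _) = w (Fin.last _)) : v = w := by
  ext p
  refine Fin.lastCases hl (fun q => ?_) p
  obtain ⟨⟨i, j⟩, rfl⟩ := finSigmaFinEquiv.surjective q
  exact h i j

lemma continuous_signCoord (k : ℕ) (m : Fin k → ℕ) : Continuous (signCoord k m) := by
  refine (PiLp.continuous_toLp 2 _).comp (continuous_pi fun p => ?_)
  refine Fin.lastCases ?_ (fun q => ?_) p
  · simp only [Fin.snoc_last]
    fun_prop
  · simp only [Fin.snoc_castSucc]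
    fun_prop

lemma norm_eq_one_iff_sum_castSucc {n : ℕ} (y : EuclideanSpace ℝ (Fin (n + 1))) :
    ‖y‖ = 1 ↔ ∑ j : Fin n, y (Fin.castSucc j) ^ 2 + y (Fin.last n) ^ 2 = 1 := by
  rw [← Fin.sum_univ_castSucc (fun j => y j ^ 2), ← EuclideanSpace.real_norm_sq_eq,
    pow_eq_one_iff_of_nonneg (norm_nonneg y) two_ne_zero]

lemma signCoord_ne_zero {k : ℕ} {m : Fin k → ℕ} {a : ∀ i, EuclideanSpace ℝ (Fin (m i + 1))}
    (ha : ∀ i, ‖a i‖ = 1) : signCoord k m a ≠ 0 := by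
  intro h
  have hx : ∀ i (j : Fin (m i)), a i (Fin.castSucc j) = 0 := fun i j => by
    rw [← signCoord_castSucc a i j, h]; rfl
  have hp : ∏ i, a i (Fin.last (m i)) = 0 := by
    rw [← signCoord_last, h]; rfl
  obtain ⟨i, -, hi⟩ := Finset.prod_eq_zero_iff.1 hp
  have := (norm_eq_one_iff_sum_castSucc (a i)).1 (ha i)
  simp [hx, hi] at this

/-- Two real families with the same absolute values and the same product differ by an even
number of sign changes. -/
lemma exists_signs_of_prod_eq {ι : Type*} [Fintype ι] (s t : ι → ℝ)
    (hsq : ∀ i, s i ^ 2 = t i ^ 2) (hp : ∏ i, s i = ∏ i, t i) :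
    ∃ ε : ι → ℝ, (∀ i, ε i = 1 ∨ ε i = -1) ∧ ∏ i, ε i = 1 ∧ ∀ i, t i = ε i * s i := by
  classical
  have hex : ∀ i, ∃ e : ℝ, (e = 1 ∨ e = -1) ∧ t i = e * s i := fun i => by
    rcases sq_eq_sq_iff_eq_or_eq_neg.1 (hsq i) with h | h
    · exact ⟨1, Or.inl rfl, by simp [h]⟩
    · exact ⟨-1, Or.inr rfl, by simp [h]⟩
  choose ε hε ht using hex
  by_cases h0 : ∏ i, s i = 0
  · obtain ⟨i₀, -, hi₀⟩ := Finset.prod_eq_zero_iff.1 h0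
    set q := ∏ i ∈ Finset.univ.erase i₀, ε i with hq
    have hq1 : q = 1 ∨ q = -1 := by
      rw [← sq_eq_one_iff, hq, ← Finset.prod_pow]
      exact Finset.prod_eq_one fun i _ => sq_eq_one_iff.2 (hε i)
    refine ⟨Function.update ε i₀ q, fun i => ?_, ?_, fun i => ?_⟩
    · rcases eq_or_ne i i₀ with rfl | hi
      · simpa using hq1
      · simpa [hi] using hε i
    · rw [← Finset.mul_prod_erase _ _ (Finset.mem_univ i₀), Function.update_self,
        Finset.prod_congr rfl fun i hi => Function.update_of_ne (Finset.ne_of_mem_erase hi) q ε,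
        ← hq, ← sq]
      exact sq_eq_one_iff.2 hq1
    · rcases eq_or_ne i i₀ with rfl | hi
      · simp [ht, hi₀]
      · simpa [hi] using ht i
  · refine ⟨ε, hε, ?_, ht⟩
    have h : ∏ i, s i = (∏ i, ε i) * ∏ i, s i := by
      rw [← Finset.prod_mul_distrib, hp]
      exact Finset.prod_congr rfl fun i _ => ht i
    exact mul_right_cancel₀ h0 (by rw [one_mul, ← h])

lemma signCoord_scale_le_one {k : ℕ} {m : Fin k → ℕ}
    {a b : ∀ i, EuclideanSpace ℝ (Fin (m i + 1))} (ha : ∀ i, ‖a i‖ = 1) (hb : ∀ i, ‖b i‖ = 1)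
    {c : ℝ} (h : signCoord k m b = c • signCoord k m a) : c ≤ 1 := by
  by_contra! hc
  have hx : ∀ i (j : Fin (m i)), b i (Fin.castSucc j) = c * a i (Fin.castSucc j) := fun i j => by
    rw [← signCoord_castSucc, h, ← signCoord_castSucc a]; rfl
  have hp : ∏ i, b i (Fin.last (m i)) = c * ∏ i, a i (Fin.last (m i)) := by
    rw [← signCoord_last, h, ← signCoord_last a]; rfl
  have hsum : ∀ i, c ^ 2 * (1 - a i (Fin.last _) ^ 2) = 1 - b i (Fin.last _) ^ 2 := fun i => by
    have h1 := (norm_eq_one_iff_sum_castSucc (a i)).1 (ha i)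
    have h2 := (norm_eq_one_iff_sum_castSucc (b i)).1 (hb i)
    simp only [hx, mul_pow, ← Finset.mul_sum] at h2
    linear_combination h2 - c ^ 2 * h1
  have hc2 : 1 < c ^ 2 := by nlinarith
  have hle : ∀ i, a i (Fin.last _) ^ 2 ≤ 1 := fun i => by
    have h1 := (norm_eq_one_iff_sum_castSucc (a i)).1 (ha i)
    have h2 : 0 ≤ ∑ j : Fin (m i), a i (Fin.castSucc j) ^ 2 :=
      Finset.sum_nonneg fun j _ => sq_nonneg _
    linarith
  by_cases h0 : ∏ i, a i (Fin.last (m i)) = 0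
  · obtain ⟨i, -, hi⟩ := Finset.prod_eq_zero_iff.1 h0
    have := hsum i
    rw [hi] at this
    nlinarith [sq_nonneg (b i (Fin.last _))]
  · have hprod : ∏ i, b i (Fin.last (m i)) ^ 2 ≤ ∏ i, a i (Fin.last (m i)) ^ 2 :=
      Finset.prod_le_prod (fun i _ => sq_nonneg _) fun i _ => by nlinarith [hsum i, hle i]
    rw [Finset.prod_pow, Finset.prod_pow, hp] at hprod
    have : 0 < (∏ i, a i (Fin.last (m i))) ^ 2 := by positivity
    nlinarith

lemma signRel_of_signCoord_eq {k : ℕ} {m : Fin k → ℕ}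
    {a b : ∀ i : Fin k, {y : EuclideanSpace ℝ (Fin (m i + 1)) // ‖y‖ = 1}}
    (h : signCoord k m (fun i => (a i).1) = signCoord k m fun i => (b i).1) :
    signRel k m a b := by
  have hx : ∀ i (j : Fin (m i)), (b i).1 (Fin.castSucc j) = (a i).1 (Fin.castSucc j) :=
    fun i j => by
      rw [← signCoord_castSucc (fun i => (b i).1), ← h, signCoord_castSucc (fun i => (a i).1)]
  obtain ⟨ε, hε, hε1, ht⟩ := exists_signs_of_prod_eq (fun i => (a i).1 (Fin.last _))
    (fun i => (b i).1 (Fin.last _))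
    (fun i => by
      have h1 := (norm_eq_one_iff_sum_castSucc (a i).1).1 (a i).2
      have h2 := (norm_eq_one_iff_sum_castSucc (b i).1).1 (b i).2
      simp only [hx] at h2
      linarith)
    (by rw [← signCoord_last (fun i => (a i).1), h, signCoord_last])
  refine ⟨ε, hε, hε1, fun i j => ?_⟩
  refine Fin.lastCases ?_ (fun j => ?_) j
  · simpa using ht i
  · simpa [Fin.castSucc_ne_last] using hx i j

lemma signCoord_eq_of_signRel {k : ℕ} {m : Fin k → ℕ}
    {a b : ∀ i : Fin k, {y : EuclideanSpace ℝ (Fin (m i + 1)) // ‖y‖ = 1}}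
    (h : signRel k m a b) :
    signCoord k m (fun i => (a i).1) = signCoord k m fun i => (b i).1 := by
  obtain ⟨ε, -, hε1, hab⟩ := h
  refine eq_of_signCoord_indices (fun i j => ?_) ?_
  · rw [signCoord_castSucc, signCoord_castSucc, hab]
    simp [Fin.castSucc_ne_last]
  · rw [signCoord_last, signCoord_last]
    simp [hab, Finset.prod_mul_distrib, hε1]

/-- The ray with "horizontal" lengths `√(q i)` and height `s` meets the hypersurface
`s = ± ∏ √(1 - q i)`. -/
lemma exists_scale_prod_sqrt {ι : Type*} [Fintype ι] [Nonempty ι] (q : ι → ℝ)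
    (hq : ∀ i, 0 ≤ q i) (s : ℝ) (hs : 0 ≤ s) (hne : s ≠ 0 ∨ ∃ i, q i ≠ 0) :
    ∃ r : ℝ, 0 < r ∧ (∀ i, r ^ 2 * q i ≤ 1) ∧ ∏ i, √(1 - r ^ 2 * q i) = r * s := by
  obtain ⟨i₀, hi₀⟩ := Finite.exists_max q
  rcases (hq i₀).eq_or_lt with h0 | h0
  · have hz : ∀ i, q i = 0 := fun i => le_antisymm (h0 ▸ hi₀ i) (hq i)
    have hs0 : s ≠ 0 := hne.resolve_right (by simpa using hz)
    exact ⟨s⁻¹, inv_pos.2 (hs.lt_of_ne' hs0), by simp [hz], by simp [hz, hs0]⟩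
  · set R : ℝ := (√(q i₀))⁻¹ with hR
    have hR0 : 0 < R := by positivity
    have hR2 : R ^ 2 * q i₀ = 1 := by
      rw [hR, inv_pow, Real.sq_sqrt h0.le, inv_mul_cancel₀ h0.ne']
    have hcont : ContinuousOn (fun r : ℝ => r * s - ∏ i, √(1 - r ^ 2 * q i)) (Set.Icc 0 R) := by
      fun_prop
    obtain ⟨r, ⟨hr0, hrR⟩, hr⟩ := intermediate_value_Icc hR0.le hcont
      (show (0 : ℝ) ∈ Set.Icc _ _ from ⟨by simp, by
        rw [Finset.prod_eq_zero (Finset.mem_univ i₀) (by simp [hR2])]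
        simpa using mul_nonneg hR0.le hs⟩)
    refine ⟨r, hr0.lt_of_ne' ?_, fun i => ?_, (sub_eq_zero.1 hr).symm⟩
    · rintro rfl
      simp at hr
    · calc r ^ 2 * q i ≤ R ^ 2 * q i₀ := by gcongr; exacts [hq i, hi₀ i]
        _ = 1 := hR2

lemma exists_signCoord_eq_smul {k : ℕ} [NeZero k] {m : Fin k → ℕ}
    {v : EuclideanSpace ℝ (Fin ((∑ i, m i) + 1))} (hv : v ≠ 0) :
    ∃ a : ∀ i, EuclideanSpace ℝ (Fin (m i + 1)), (∀ i, ‖a i‖ = 1) ∧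
      ∃ r : ℝ, 0 < r ∧ signCoord k m a = r • v := by
  set x : ∀ i, Fin (m i) → ℝ := fun i j => v (Fin.castSucc (finSigmaFinEquiv ⟨i, j⟩)) with hx
  obtain ⟨r, hr0, hr1, hr⟩ := exists_scale_prod_sqrt (fun i => ∑ j, x i j ^ 2)
    (fun i => Finset.sum_nonneg fun j _ => sq_nonneg _) |v (Fin.last _)| (abs_nonneg _) (by
      by_contra! h
      refine hv (eq_of_signCoord_indices (fun i j => ?_) (by simpa using h.1))
      have := (Finset.sum_eq_zero_iff_of_nonneg fun j _ => sq_nonneg (x i j)).1 (h.2 i) j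
        (Finset.mem_univ j)
      simpa using this)
  obtain ⟨σ, hσ, hσv⟩ : ∃ σ : ℝ, σ ^ 2 = 1 ∧ σ * |v (Fin.last _)| = v (Fin.last _) := by
    rcases abs_choice (v (Fin.last _)) with h | h
    · exact ⟨1, by norm_num, by rw [h, one_mul]⟩
    · exact ⟨-1, by norm_num, by rw [h]; ring⟩
  refine ⟨fun i => WithLp.toLp 2 (Fin.snoc (α := fun _ => ℝ) (fun j => r * x i j)
    ((if i = 0 then σ else 1) * √(1 - r ^ 2 * ∑ j, x i j ^ 2))), fun i => ?_, r, hr0,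
    eq_of_signCoord_indices (fun i j => ?_) ?_⟩
  · rw [norm_eq_one_iff_sum_castSucc]
    simp only [Fin.snoc_castSucc, Fin.snoc_last, mul_pow, ← Finset.mul_sum]
    rw [Real.sq_sqrt (sub_nonneg.2 (hr1 i))]
    split_ifs <;> simp [hσ]
  · rw [signCoord_castSucc]
    simp [hx]
  · rw [signCoord_last]
    simp only [Fin.snoc_last, Finset.prod_mul_distrib, hr, PiLp.smul_apply, smul_eq_mul,
      Finset.prod_ite_eq', Finset.mem_univ, if_true]
    linear_combination r * hσv

/-- The radial projection of `signCoord` to the unit sphere. -/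
def signSphereMap (k : ℕ) (m : Fin k → ℕ)
    (a : ∀ i : Fin k, {y : EuclideanSpace ℝ (Fin (m i + 1)) // ‖y‖ = 1}) :
    Metric.sphere (0 : EuclideanSpace ℝ (Fin ((∑ i, m i) + 1))) 1 :=
  ⟨‖signCoord k m fun i => (a i).1‖⁻¹ • signCoord k m fun i => (a i).1, by
    simpa using norm_smul_inv_norm (𝕜 := ℝ) (signCoord_ne_zero fun i => (a i).2)⟩

lemma continuous_signSphereMap (k : ℕ) (m : Fin k → ℕ) : Continuous (signSphereMap k m) := by
  have h : Continuous fun a : ∀ i : Fin k, {y : EuclideanSpace ℝ (Fin (m i + 1)) // ‖y‖ = 1} =>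
      signCoord k m fun i => (a i).1 :=
    (continuous_signCoord k m).comp (by fun_prop)
  exact ((h.norm.inv₀ fun a => norm_ne_zero_iff.2 (signCoord_ne_zero fun i => (a i).2)).smul
    h).subtype_mk _

lemma signSphereMap_eq_iff {k : ℕ} {m : Fin k → ℕ}
    {a b : ∀ i : Fin k, {y : EuclideanSpace ℝ (Fin (m i + 1)) // ‖y‖ = 1}} :
    signSphereMap k m a = signSphereMap k m b ↔ signRel k m a b := by
  refine ⟨fun h => signRel_of_signCoord_eq ?_, fun h => ?_⟩
  · have h' := congrArg Subtype.val h
    simp only [signSphereMap] at h'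
    set A := signCoord k m fun i => (a i).1 with hA
    set B := signCoord k m fun i => (b i).1 with hB
    have hA0 : 0 < ‖A‖ := norm_pos_iff.2 (signCoord_ne_zero fun i => (a i).2)
    have hB0 : 0 < ‖B‖ := norm_pos_iff.2 (signCoord_ne_zero fun i => (b i).2)
    have hBA : B = (‖B‖ / ‖A‖) • A := by
      rw [div_eq_mul_inv, mul_smul, h', smul_inv_smul₀ hB0.ne']
    have hAB : A = (‖A‖ / ‖B‖) • B := by
      rw [div_eq_mul_inv, mul_smul, ← h', smul_inv_smul₀ hA0.ne']
    have h1 := signCoord_scale_le_one (fun i => (a i).2) (fun i => (b i).2) hBA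
    have h2 := signCoord_scale_le_one (fun i => (b i).2) (fun i => (a i).2) hAB
    rw [div_le_one₀ hA0] at h1
    rw [div_le_one₀ hB0] at h2
    rw [hBA, le_antisymm h1 h2, div_self hA0.ne', one_smul]
  · simp only [signSphereMap, signCoord_eq_of_signRel h]

lemma surjective_signSphereMap (k : ℕ) [NeZero k] (m : Fin k → ℕ) :
    Function.Surjective (signSphereMap k m) := by
  rintro ⟨v, hv⟩
  have hv1 : ‖v‖ = 1 := by simpa using hv
  obtain ⟨a, ha, r, hr, hav⟩ := exists_signCoord_eq_smul (m := m)
    (norm_ne_zero_iff.1 (hv1 ▸ one_ne_zero))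
  refine ⟨fun i => ⟨a i, ha i⟩, Subtype.ext ?_⟩
  simp only [signSphereMap]
  rw [hav, norm_smul, hv1, mul_one, Real.norm_of_nonneg hr.le, inv_smul_smul₀ hr.ne']

/-- for `k ≥ 2` and `m i ≥ 1`, the orbit space
`(S^{m₁} × ⋯ × S^{m_k})/G_k` is homeomorphic to the sphere `S^m`, `m = m₁ + ⋯ + m_k`. -/
theorem stmt0 (k : ℕ) (hk : 2 ≤ k) (m : Fin k → ℕ) (hm : ∀ i, 1 ≤ m i) :
    Nonempty (Quot (signRel k m) ≃ₜ
      Metric.sphere (0 : EuclideanSpace ℝ (Fin ((∑ i, m i) + 1))) 1) := by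
  have : NeZero k := ⟨by omega⟩
  have : ∀ i, CompactSpace {y : EuclideanSpace ℝ (Fin (m i + 1)) // ‖y‖ = 1} := fun i =>
    isCompact_iff_compactSpace.1 <|
      show IsCompact {y : EuclideanSpace ℝ (Fin (m i + 1)) | ‖y‖ = 1} by
        simpa [Metric.sphere] using isCompact_sphere (0 : EuclideanSpace ℝ (Fin (m i + 1))) 1
  let f := Quot.lift (signSphereMap k m) fun _ _ => signSphereMap_eq_iff.2
  have hf : Continuous f := continuous_quot_lift _ (continuous_signSphereMap k m)
  have hbij : Function.Bijective f := by
    refine ⟨?_, fun v => (surjective_signSphereMap k m v).imp' (Quot.mk _) fun _ h => h⟩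
    rintro ⟨a⟩ ⟨b⟩ h
    exact Quot.sound (signSphereMap_eq_iff.1 h)
  exact ⟨Continuous.homeoOfEquivCompactToT2 (f := Equiv.ofBijective f hbij) hf⟩
end
end

section
/- Let k ≥ 2 and m₁,…,m_k ≥ 2. The orbit space (S^{m₁} × S^{m₂} × ⋯ × S^{m_k})/T^{k−1} of the product of spheres by the described action of the torus T^{k−1} is homeomorphic to the sphere S^m, where m = m₁ + ⋯ + m_k − (k−1). -/
open scoped BigOperators

noncomputable section

def chainExt (k : ℕ) {G : Type*} [One G] (r : Fin (k - 1) → G) (j : ℕ) : G :=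
  if h : 1 ≤ j ∧ j ≤ k - 1 then r ⟨j - 1, by omega⟩ else 1

/-- The orbit relation of the torus `T^{k-1} = U(1)^{k-1}` acting on the product of the
spheres `S^{m i} = {(x, z) ∈ ℝ^{m i - 1} × ℂ : |x|² + |z|² = 1}` by
`(r₁,…,r_{k-1})·((x₁,z₁),…,(x_k,z_k)) = ((x₁, z₁r₁⁻¹), (x₂, r₁z₂r₂⁻¹), …, (x_k, r_{k-1}z_k))`. -/
def tRel (k : ℕ) (m : Fin k → ℕ)
    (a b : ∀ i : Fin k,
      {p : EuclideanSpace ℝ (Fin (m i - 1)) × ℂ // ‖p.1‖ ^ 2 + ‖p.2‖ ^ 2 = 1}) : Prop :=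
  ∃ r : Fin (k - 1) → ℂ, (∀ j, ‖r j‖ = 1) ∧
    ∀ i : Fin k, (b i).1.1 = (a i).1.1 ∧
      (b i).1.2 = chainExt k r (i : ℕ) * (a i).1.2 * (chainExt k r ((i : ℕ) + 1))⁻¹

theorem chainExt_zero (k : ℕ) {G : Type*} [One G] (r : Fin (k - 1) → G) :
    chainExt k r 0 = 1 := by
  simp [chainExt]

theorem chainExt_self (k : ℕ) (hk : 1 ≤ k) {G : Type*} [One G] (r : Fin (k - 1) → G) :
    chainExt k r k = 1 := by
  unfold chainExt
  rw [dif_neg]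
  omega

theorem norm_chainExt (k : ℕ) (r : Fin (k - 1) → ℂ) (hr : ∀ j, ‖r j‖ = 1) (j : ℕ) :
    ‖chainExt k r j‖ = 1 := by
  unfold chainExt
  split_ifs
  · exact hr _
  · simp

theorem prod_chainExt_mul_inv (k : ℕ) (hk : 1 ≤ k) (r : Fin (k - 1) → ℂ)
    (hr : ∀ j, ‖r j‖ = 1) :
    ∏ i : Fin k, (chainExt k r (i : ℕ) * (chainExt k r ((i : ℕ) + 1))⁻¹) = 1 := by
  have hne (j : ℕ) : chainExt k r j ≠ 0 := by
    rw [← norm_ne_zero_iff, norm_chainExt k r hr]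
    exact one_ne_zero
  have key (n : ℕ) : ∏ i ∈ Finset.range n, (chainExt k r i * (chainExt k r (i + 1))⁻¹) =
      (chainExt k r n)⁻¹ := by
    induction n with
    | zero => simp [chainExt_zero]
    | succ n ih => rw [Finset.prod_range_succ, ih, inv_mul_cancel_left₀ (hne n)]
  rw [Fin.prod_univ_eq_prod_range (fun i => chainExt k r i * (chainExt k r (i + 1))⁻¹) k, key,
    chainExt_self k hk, inv_one]

/-- The torus `T^{k-1}` acts through all of `{t ∈ T^k : ∏ t i = 1}`. -/
theorem exists_chainExt_eq (k : ℕ) (t : Fin k → ℂ) (ht : ∀ i, ‖t i‖ = 1)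
    (hprod : ∏ i, t i = 1) :
    ∃ r : Fin (k - 1) → ℂ, (∀ j, ‖r j‖ = 1) ∧
      ∀ i : Fin k, chainExt k r (i : ℕ) * (chainExt k r ((i : ℕ) + 1))⁻¹ = t i := by
  set T : ℕ → ℂ := fun n => if h : n < k then t ⟨n, h⟩ else 1 with hT
  have hTn (n : ℕ) : ‖T n‖ = 1 := by
    simp only [hT]
    split_ifs
    · exact ht _
    · simp
  have hTt (i : Fin k) : T i = t i := by simp [hT]
  set P : ℕ → ℂ := fun n => ∏ i ∈ Finset.range n, T i with hP
  have hPn (n : ℕ) : ‖P n‖ = 1 := by simp [hP, norm_prod, hTn]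
  have hPne (n : ℕ) : P n ≠ 0 := by
    rw [← norm_ne_zero_iff, hPn]
    exact one_ne_zero
  have hPk : P k = 1 := by
    rw [← hprod, hP]
    simp only
    rw [← Fin.prod_univ_eq_prod_range]
    exact Finset.prod_congr rfl fun i _ => hTt i
  have hc (n : ℕ) (hn : n ≤ k) : chainExt k (fun j : Fin (k - 1) => (P (j + 1))⁻¹) n =
      (P n)⁻¹ := by
    unfold chainExt
    split_ifs with h
    · simp only
      rw [Nat.sub_add_cancel h.1]
    · obtain rfl | rfl : n = 0 ∨ n = k := by omega
      · simp [hP]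
      · simp [hPk]
  refine ⟨fun j => (P (j + 1))⁻¹, fun j => by simp [hPn], fun i => ?_⟩
  rw [hc i i.2.le, hc (i + 1) i.2, inv_inv, ← hTt]
  have : P (i + 1) = P i * T i := Finset.prod_range_succ _ _
  rw [this, inv_mul_cancel_left₀ (hPne i)]

theorem exists_unit_smul_of_norm_eq {ι : Type*} [Fintype ι] [DecidableEq ι] (z z' : ι → ℂ)
    (hn : ∀ i, ‖z' i‖ = ‖z i‖) (hp : ∏ i, z' i = ∏ i, z i) :
    ∃ t : ι → ℂ, (∀ i, ‖t i‖ = 1) ∧ ∏ i, t i = 1 ∧ ∀ i, z' i = t i * z i := by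
  set c : ι → ℂ := fun i => if z i = 0 then 1 else z' i / z i with hc
  have hcn (i : ι) : ‖c i‖ = 1 := by
    simp only [hc]
    split_ifs with h
    · simp
    · rw [norm_div, hn, div_self (norm_ne_zero_iff.2 h)]
  have hcz (i : ι) : z' i = c i * z i := by
    simp only [hc]
    split_ifs with h
    · rw [h, mul_zero, ← norm_eq_zero, hn, h, norm_zero]
    · rw [div_mul_cancel₀ _ h]
  by_cases h : ∃ i, z i = 0
  · obtain ⟨i₀, h₀⟩ := h
    refine ⟨fun i => c i * (Pi.mulSingle i₀ (∏ i, c i)⁻¹ : ι → ℂ) i, fun i => ?_, ?_, fun i => ?_⟩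
    · rw [norm_mul, hcn, one_mul]
      by_cases hi : i = i₀
      · subst hi
        simp [norm_prod, hcn]
      · simp [hi]
    · rw [Finset.prod_mul_distrib, Finset.prod_pi_mulSingle', if_pos (Finset.mem_univ _)]
      refine mul_inv_cancel₀ ?_
      rw [← norm_ne_zero_iff, norm_prod]
      simp [hcn]
    · by_cases hi : i = i₀
      · subst hi
        rw [hcz, h₀, mul_zero, mul_zero]
      · simp [hi, hcz i]
  · push Not at h
    refine ⟨c, hcn, ?_, hcz⟩
    simp only [hcz, Finset.prod_mul_distrib] at hp
    exact mul_right_cancel₀ (Finset.prod_ne_zero_iff.2 fun i _ => h i) (by rw [hp, one_mul])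

theorem exists_prod_eq_of_norm {ι : Type*} [Fintype ι] [DecidableEq ι] [Nonempty ι]
    (ρ : ι → ℝ) (hρ : ∀ i, 0 ≤ ρ i) (w : ℂ) (hw : ‖w‖ ^ 2 = ∏ i, ρ i) :
    ∃ z : ι → ℂ, (∀ i, ‖z i‖ ^ 2 = ρ i) ∧ ∏ i, z i = w := by
  obtain ⟨i₀⟩ := ‹Nonempty ι›
  set c : ℂ := Complex.exp (w.arg * Complex.I) with hc
  have hcn : ‖c‖ = 1 := Complex.norm_exp_ofReal_mul_I _
  refine ⟨fun i => (√(ρ i) : ℂ) * (Pi.mulSingle i₀ c : ι → ℂ) i, fun i => ?_, ?_⟩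
  · have : ‖(Pi.mulSingle i₀ c : ι → ℂ) i‖ = 1 := by
      by_cases hi : i = i₀
      · subst hi
        simp [hcn]
      · simp [hi]
    rw [norm_mul, this, mul_one, Complex.norm_real, Real.norm_of_nonneg (Real.sqrt_nonneg _),
      Real.sq_sqrt (hρ i)]
  · rw [Finset.prod_mul_distrib, Finset.prod_pi_mulSingle', if_pos (Finset.mem_univ _)]
    have h : ∏ i, √(ρ i) = ‖w‖ := by
      rw [← Real.sqrt_sq (norm_nonneg w), hw, Real.sqrt_prod _ fun i _ => hρ i]
    rw [← Complex.ofReal_prod, h, hc, Complex.norm_mul_exp_arg_mul_I]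

/-- Every ray from the origin of `ℝ^ι × ℝ` in the nonnegative orthant meets the hypersurface
`b² = ∏ (1 - (a i)²)`, `a i ≤ 1`. -/
theorem exists_pos_sq_eq_prod {ι : Type*} [Fintype ι] [Nonempty ι] (a : ι → ℝ) (b : ℝ)
    (ha : ∀ i, 0 ≤ a i) (h : (∃ i, a i ≠ 0) ∨ b ≠ 0) :
    ∃ t : ℝ, 0 < t ∧ (∀ i, 0 ≤ 1 - (t * a i) ^ 2) ∧
      (t * b) ^ 2 = ∏ i, (1 - (t * a i) ^ 2) := by
  obtain ⟨i₀, -, hi₀⟩ := Finset.exists_max_image Finset.univ a Finset.univ_nonempty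
  obtain ⟨s, hs, hs1, hs2⟩ : ∃ s : ℝ, 0 < s ∧ (∀ i, s * a i ≤ 1) ∧
      ∏ i, (1 - (s * a i) ^ 2) ≤ (s * b) ^ 2 := by
    by_cases h0 : a i₀ = 0
    · have ha0 (i : ι) : a i = 0 := le_antisymm (h0 ▸ hi₀ i (Finset.mem_univ i)) (ha i)
      have hb : b ≠ 0 := h.resolve_left (by simp [ha0])
      refine ⟨|b|⁻¹, by positivity, fun i => by simp [ha0], ?_⟩
      simp only [ha0, mul_zero]
      rw [mul_pow, inv_pow, sq_abs, inv_mul_cancel₀ (by positivity)]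
      simp
    · have hpos : 0 < a i₀ := lt_of_le_of_ne (ha i₀) (Ne.symm h0)
      refine ⟨(a i₀)⁻¹, by positivity, fun i => ?_, ?_⟩
      · rw [inv_mul_le_one₀ hpos]
        exact hi₀ i (Finset.mem_univ i)
      · rw [Finset.prod_eq_zero (Finset.mem_univ i₀) (by rw [inv_mul_cancel₀ h0]; norm_num)]
        positivity
  have hcont : ContinuousOn (fun t : ℝ => (t * b) ^ 2 - ∏ i, (1 - (t * a i) ^ 2))
      (Set.Icc 0 s) := by fun_prop
  obtain ⟨t, ⟨ht0, hts⟩, ht⟩ := intermediate_value_Icc hs.le hcont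
    (show (0 : ℝ) ∈ Set.Icc _ _ from ⟨by simp, by simpa using hs2⟩)
  simp only at ht
  refine ⟨t, lt_of_le_of_ne ht0 ?_, fun i => ?_, sub_eq_zero.1 ht⟩
  · rintro rfl
    simp at ht
  · have h1 : t * a i ≤ 1 := (mul_le_mul_of_nonneg_right hts (ha i)).trans (hs1 i)
    have h2 : 0 ≤ t * a i := mul_nonneg ht0 (ha i)
    nlinarith

/-- A ray from the origin meets the hypersurface `b² = ∏ (1 - (a i)²)`, `(a i)² ≤ 1`, at most
once. -/
theorem one_le_of_sq_eq_prod {ι : Type*} [Fintype ι] (a : ι → ℝ) (b s : ℝ) (hs : 0 ≤ s)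
    (h1 : ∀ i, 0 ≤ 1 - a i ^ 2) (hb : b ^ 2 = ∏ i, (1 - a i ^ 2))
    (hsb : (s * b) ^ 2 = ∏ i, (1 - (s * a i) ^ 2)) : 1 ≤ s := by
  by_contra! hlt
  have hs2 : s ^ 2 < 1 := by nlinarith
  have hle : b ^ 2 ≤ (s * b) ^ 2 := by
    rw [hb, hsb]
    refine Finset.prod_le_prod (fun i _ => h1 i) fun i _ => ?_
    nlinarith [sq_nonneg (a i)]
  have hb0 : b ^ 2 = 0 := by nlinarith [sq_nonneg b]
  have hpos : 0 < ∏ i, (1 - (s * a i) ^ 2) := by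
    refine Finset.prod_pos fun i _ => ?_
    nlinarith [sq_nonneg (a i), h1 i]
  rw [← hsb, mul_pow, hb0, mul_zero] at hpos
  exact lt_irrefl _ hpos

theorem compactSpace_prod_sphere (E F : Type*) [NormedAddCommGroup E] [NormedAddCommGroup F]
    [ProperSpace E] [ProperSpace F] :
    CompactSpace {p : E × F // ‖p.1‖ ^ 2 + ‖p.2‖ ^ 2 = 1} := by
  suffices IsCompact {p : E × F | ‖p.1‖ ^ 2 + ‖p.2‖ ^ 2 = 1} from
    isCompact_iff_compactSpace.1 this
  refine (isCompact_closedBall (0 : E × F) 1).of_isClosed_subset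
    (isClosed_eq (by fun_prop) continuous_const) fun p (hp : _ = _) => ?_
  rw [mem_closedBall_zero_iff, Prod.norm_def, max_le_iff]
  constructor <;> nlinarith [sq_nonneg ‖p.1‖, sq_nonneg ‖p.2‖, norm_nonneg p.1, norm_nonneg p.2]

/-- A continuous surjection from a compact space to a Hausdorff space descends to a homeomorphism
from the quotient by the relation of having equal images. -/
theorem nonempty_quot_homeomorph {X Y : Type*} [TopologicalSpace X] [TopologicalSpace Y]
    [CompactSpace X] [T2Space Y] (R : X → X → Prop) (f : X → Y) (hf : Continuous f)
    (hsurj : Function.Surjective f) (hR : ∀ a b, R a b ↔ f a = f b) :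
    Nonempty (Quot R ≃ₜ Y) := by
  let g : Quot R → Y := Quot.lift f fun a b h => (hR a b).1 h
  have hg : Continuous g := continuous_quot_lift _ hf
  have hbij : Function.Bijective g := by
    refine ⟨?_, fun y => ?_⟩
    · rintro ⟨a⟩ ⟨b⟩ h
      exact Quot.sound ((hR a b).2 h)
    · obtain ⟨x, rfl⟩ := hsurj y
      exact ⟨Quot.mk R x, rfl⟩
  exact ⟨Continuous.homeoOfEquivCompactToT2 (f := Equiv.ofBijective g hbij) hg⟩

/-- The invariants of the action: the Euclidean components and the product of the complex ones. -/
def orbitInvariant {ι : Type*} [Fintype ι] {E : ι → Type*} [∀ i, NormedAddCommGroup (E i)]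
    (a : ∀ i, {p : E i × ℂ // ‖p.1‖ ^ 2 + ‖p.2‖ ^ 2 = 1}) : (∀ i, E i) × ℂ :=
  (fun i => (a i).1.1, ∏ i, (a i).1.2)

section OrbitInvariant

variable {ι : Type*} [Fintype ι] {E : ι → Type*} [∀ i, NormedAddCommGroup (E i)]

theorem continuous_orbitInvariant : Continuous (orbitInvariant (ι := ι) (E := E)) := by
  unfold orbitInvariant
  fun_prop

theorem norm_sq_eq_one_sub {F : Type*} [NormedAddCommGroup F]
    (p : {p : F × ℂ // ‖p.1‖ ^ 2 + ‖p.2‖ ^ 2 = 1}) : ‖p.1.2‖ ^ 2 = 1 - ‖p.1.1‖ ^ 2 := by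
  linarith [p.2]

theorem orbitInvariant_snd_norm_sq
    (a : ∀ i, {p : E i × ℂ // ‖p.1‖ ^ 2 + ‖p.2‖ ^ 2 = 1}) :
    ‖(orbitInvariant a).2‖ ^ 2 = ∏ i, (1 - ‖(orbitInvariant a).1 i‖ ^ 2) := by
  simp only [orbitInvariant, norm_prod, ← Finset.prod_pow, norm_sq_eq_one_sub]

theorem one_sub_orbitInvariant_fst_nonneg
    (a : ∀ i, {p : E i × ℂ // ‖p.1‖ ^ 2 + ‖p.2‖ ^ 2 = 1}) (i : ι) :
    0 ≤ 1 - ‖(orbitInvariant a).1 i‖ ^ 2 := by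
  have := norm_sq_eq_one_sub (a i)
  simp only [orbitInvariant]
  rw [← this]
  positivity

theorem orbitInvariant_ne_zero
    (a : ∀ i, {p : E i × ℂ // ‖p.1‖ ^ 2 + ‖p.2‖ ^ 2 = 1}) : orbitInvariant a ≠ 0 := by
  intro h
  have := orbitInvariant_snd_norm_sq a
  simp [h] at this

variable [∀ i, NormedSpace ℝ (E i)]

theorem one_le_of_orbitInvariant_eq_smul
    (a b : ∀ i, {p : E i × ℂ // ‖p.1‖ ^ 2 + ‖p.2‖ ^ 2 = 1}) {s : ℝ} (hs : 0 ≤ s)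
    (h : orbitInvariant b = s • orbitInvariant a) : 1 ≤ s := by
  refine one_le_of_sq_eq_prod (fun i => ‖(orbitInvariant a).1 i‖) ‖(orbitInvariant a).2‖ s hs
    (one_sub_orbitInvariant_fst_nonneg a) (orbitInvariant_snd_norm_sq a) ?_
  have := orbitInvariant_snd_norm_sq b
  simpa only [h, Prod.smul_fst, Prod.smul_snd, Pi.smul_apply, norm_smul,
    Real.norm_of_nonneg hs] using this

theorem orbitInvariant_eq_of_eq_smul
    (a b : ∀ i, {p : E i × ℂ // ‖p.1‖ ^ 2 + ‖p.2‖ ^ 2 = 1}) {s : ℝ} (hs : 0 < s)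
    (h : orbitInvariant b = s • orbitInvariant a) : orbitInvariant b = orbitInvariant a := by
  have h1 := one_le_of_orbitInvariant_eq_smul a b hs.le h
  have h2 := one_le_of_orbitInvariant_eq_smul b a (inv_nonneg.2 hs.le)
    (by rw [h, inv_smul_smul₀ hs.ne'])
  rw [one_le_inv₀ hs] at h2
  rw [h, le_antisymm h2 h1, one_smul]

theorem exists_orbitInvariant_eq_smul [DecidableEq ι] [Nonempty ι] (e : (∀ i, E i) × ℂ)
    (he : e ≠ 0) :
    ∃ (a : ∀ i, {p : E i × ℂ // ‖p.1‖ ^ 2 + ‖p.2‖ ^ 2 = 1}) (t : ℝ), 0 < t ∧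
      orbitInvariant a = t • e := by
  obtain ⟨t, ht, h0, hprod⟩ := exists_pos_sq_eq_prod (fun i => ‖e.1 i‖) ‖e.2‖
    (fun i => norm_nonneg _) (by
      by_contra! h
      exact he (Prod.ext (funext fun i => norm_eq_zero.1 (h.1 i)) (norm_eq_zero.1 h.2)))
  obtain ⟨z, hz, hzw⟩ := exists_prod_eq_of_norm _ h0 (t • e.2) (by
    rw [norm_smul, Real.norm_of_nonneg ht.le, hprod])
  refine ⟨fun i => ⟨(t • e.1 i, z i), ?_⟩, t, ht, Prod.ext rfl hzw⟩
  simp only [hz, norm_smul, Real.norm_of_nonneg ht.le]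
  ring

end OrbitInvariant

theorem tRel_iff_orbitInvariant_eq (k : ℕ) (hk : 1 ≤ k) (m : Fin k → ℕ)
    (a b : ∀ i : Fin k,
      {p : EuclideanSpace ℝ (Fin (m i - 1)) × ℂ // ‖p.1‖ ^ 2 + ‖p.2‖ ^ 2 = 1}) :
    tRel k m a b ↔ orbitInvariant a = orbitInvariant b := by
  constructor
  · rintro ⟨r, hr, h⟩
    refine Prod.ext (funext fun i => (h i).1.symm) ?_
    simp only [orbitInvariant, fun i => (h i).2, mul_right_comm _ (a _).1.2]
    rw [Finset.prod_mul_distrib, prod_chainExt_mul_inv k hk r hr, one_mul]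
  · intro h
    have hx (i : Fin k) : (b i).1.1 = (a i).1.1 := (congrFun (congrArg Prod.fst h) i).symm
    obtain ⟨t, ht, hprod, hz⟩ := exists_unit_smul_of_norm_eq (fun i => (a i).1.2)
      (fun i => (b i).1.2) (fun i => by
        rw [← sq_eq_sq₀ (norm_nonneg _) (norm_nonneg _), norm_sq_eq_one_sub,
          norm_sq_eq_one_sub, hx]) (congrArg Prod.snd h).symm
    obtain ⟨r, hr, hrt⟩ := exists_chainExt_eq k t ht hprod
    refine ⟨r, hr, fun i => ⟨hx i, ?_⟩⟩
    rw [mul_right_comm, hrt, hz]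

theorem finrank_invariants (k : ℕ) (hk : 1 ≤ k) (m : Fin k → ℕ) (hm : ∀ i, 1 ≤ m i) :
    Module.finrank ℝ ((∀ i, EuclideanSpace ℝ (Fin (m i - 1))) × ℂ) =
      (∑ i, m i) - (k - 1) + 1 := by
  have h : ∑ i, (m i - 1) + k = ∑ i, m i := by
    calc ∑ i, (m i - 1) + k = ∑ i, ((m i - 1) + 1) := by simp [Finset.sum_add_distrib]
      _ = ∑ i, m i := Finset.sum_congr rfl fun i _ => Nat.sub_add_cancel (hm i)
  rw [Module.finrank_prod, Module.finrank_pi_fintype, Complex.finrank_real_complex]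
  simp only [finrank_euclideanSpace, Fintype.card_fin]
  omega

/-- for `k ≥ 2` and `m i ≥ 2`, the orbit space
`(S^{m₁} × ⋯ × S^{m_k})/T^{k-1}` is homeomorphic to the sphere `S^m`,
`m = m₁ + ⋯ + m_k - (k-1)`. -/
theorem stmt2 (k : ℕ) (hk : 2 ≤ k) (m : Fin k → ℕ) (hm : ∀ i, 2 ≤ m i) :
    Nonempty (Quot (tRel k m) ≃ₜ
      Metric.sphere (0 : EuclideanSpace ℝ (Fin ((∑ i, m i) - (k - 1) + 1))) 1) := by
  have : Nonempty (Fin k) := ⟨⟨0, by omega⟩⟩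
  have (i : Fin k) := compactSpace_prod_sphere (EuclideanSpace ℝ (Fin (m i - 1))) ℂ
  let L : ((∀ i, EuclideanSpace ℝ (Fin (m i - 1))) × ℂ) ≃L[ℝ]
      EuclideanSpace ℝ (Fin ((∑ i, m i) - (k - 1) + 1)) :=
    ContinuousLinearEquiv.ofFinrankEq (by
      rw [finrank_invariants k (by omega) m fun i => one_le_two.trans (hm i),
        finrank_euclideanSpace, Fintype.card_fin])
  have hL0 (a : ∀ i : Fin k,
      {p : EuclideanSpace ℝ (Fin (m i - 1)) × ℂ // ‖p.1‖ ^ 2 + ‖p.2‖ ^ 2 = 1}) :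
      ‖L (orbitInvariant a)‖ ≠ 0 := by
    rw [norm_ne_zero_iff]
    exact (map_ne_zero_iff L L.injective).2 (orbitInvariant_ne_zero a)
  have hLpos a := lt_of_le_of_ne (norm_nonneg _) (hL0 a).symm
  refine nonempty_quot_homeomorph _
    (fun a => ⟨‖L (orbitInvariant a)‖⁻¹ • L (orbitInvariant a), ?_⟩) ?_ ?_ ?_
  · rw [mem_sphere_zero_iff_norm, norm_smul, norm_inv, norm_norm, inv_mul_cancel₀ (hL0 a)]
  · have hc : Continuous fun a => L (orbitInvariant a) :=
      L.continuous.comp (continuous_orbitInvariant (E := fun i => EuclideanSpace ℝ (Fin (m i - 1))))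
    exact ((hc.norm.inv₀ hL0).smul hc).subtype_mk _
  · rintro ⟨y, hy⟩
    rw [mem_sphere_zero_iff_norm] at hy
    obtain ⟨a, t, ht, hat⟩ := exists_orbitInvariant_eq_smul (L.symm y)
      ((map_ne_zero_iff L.symm L.symm.injective).2 (by rw [← norm_ne_zero_iff, hy]; norm_num))
    refine ⟨a, Subtype.ext ?_⟩
    simp only
    rw [hat, map_smul, L.apply_symm_apply, norm_smul, hy, mul_one, Real.norm_of_nonneg ht.le,
      inv_smul_smul₀ ht.ne']
  · intro a b
    rw [tRel_iff_orbitInvariant_eq k (by omega)]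
    refine ⟨fun h => Subtype.ext (by simp only [h]), fun h => ?_⟩
    have h := congrArg Subtype.val h
    simp only at h
    refine orbitInvariant_eq_of_eq_smul b a
      (s := ‖L (orbitInvariant a)‖ * ‖L (orbitInvariant b)‖⁻¹)
      (mul_pos (hLpos a) (inv_pos.2 (hLpos b))) (L.injective ?_)
    rw [map_smul, mul_smul, ← h, smul_inv_smul₀ (hL0 a)]
end
end

section
/- Let k ≥ 2, m₁,…,m_k ≥ 4 and m = m₁ + ⋯ + m_k − 3(k−1). For every unit vector (t₁, …, t_k, t) in ℝ^{m₁−3} × ⋯ × ℝ^{m_k−3} × ℍ ≅ ℝ^{m+1} there exists a point ((x₁,q₁),…,(x_k,q_k)) ∈ S^{m₁} × ⋯ × S^{m_k} and a real number μ > 0 with (x₁, …, x_k, q₁q₂⋯q_k) = μ·(t₁, …, t_k, t); that is, the normalized map ((x₁,q₁),…,(x_k,q_k)) ↦ (x₁,…,x_k,q₁⋯q_k)/|(x₁,…,x_k,q₁⋯q_k)| is surjective onto the unit sphere S^m. -/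
open scoped BigOperators

noncomputable section

/-- The sphere `S^{m i} = {(x, q) ∈ ℝ^{m i - 3} × ℍ : |x|² + |q|² = 1}`. -/
abbrev SpSphere (n : ℕ) : Type :=
  {p : EuclideanSpace ℝ (Fin n) × Quaternion ℝ // ‖p.1‖ ^ 2 + ‖p.2‖ ^ 2 = 1}

/-- The factors of a product that is scaled onto a ray: there is `μ > 0` at which the product of the
heights `√(1 - (μ c i)²)` meets the line `μ ↦ μ d`, while all `μ c i` are still at most `1`. -/
theorem exists_pos_prod_sqrt_eq_mul {ι : Type*} [Fintype ι] (c : ι → ℝ) (hc : ∀ i, 0 ≤ c i)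
    {d : ℝ} (hd : 0 ≤ d) (h : (∑ i, c i ^ 2) + d ^ 2 = 1) :
    ∃ μ : ℝ, 0 < μ ∧ (∀ i, (μ * c i) ^ 2 ≤ 1) ∧ ∏ i, √(1 - (μ * c i) ^ 2) = μ * d := by
  by_cases h0 : ∀ i, c i = 0
  · have hd1 : d = 1 := by
      simp only [h0] at h
      norm_num at h
      rcases h with h | h <;> linarith
    exact ⟨1, one_pos, by simp [h0], by simp [h0, hd1]⟩
  · push Not at h0
    obtain ⟨j, hj⟩ := h0
    obtain ⟨l, -, hl⟩ := Finset.exists_max_image Finset.univ c ⟨j, Finset.mem_univ j⟩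
    have hl' : ∀ i, c i ≤ c l := fun i => hl i (Finset.mem_univ i)
    have hpos : 0 < c l := ((hc j).lt_of_ne' hj).trans_le (hl' j)
    have hcont : ContinuousOn (fun μ : ℝ => (∏ i, √(1 - (μ * c i) ^ 2)) - μ * d)
        (Set.Icc 0 (c l)⁻¹) := by fun_prop
    have hend : (∏ i, √(1 - ((c l)⁻¹ * c i) ^ 2)) = 0 :=
      Finset.prod_eq_zero (Finset.mem_univ l) (by simp [hpos.ne'])
    obtain ⟨μ, ⟨hμ0, hμ1⟩, hμ⟩ := intermediate_value_Icc' (inv_pos.2 hpos).le hcont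
      (show (0 : ℝ) ∈ Set.Icc _ _ by
        refine ⟨?_, by simp⟩
        simp only [hend, zero_sub, Left.neg_nonpos_iff]
        positivity)
    refine ⟨μ, hμ0.lt_of_ne ?_, fun i => ?_, sub_eq_zero.1 hμ⟩
    · rintro rfl
      simp at hμ
    · refine pow_le_one₀ (mul_nonneg hμ0 (hc i)) ?_
      calc μ * c i ≤ (c l)⁻¹ * c l := mul_le_mul hμ1 (hl' i) (hc i) (inv_pos.2 hpos).le
        _ = 1 := inv_mul_cancel₀ hpos.ne'

/-- A quaternion is its norm times a unit quaternion. -/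
theorem Quaternion.exists_norm_eq_one_smul (q : Quaternion ℝ) :
    ∃ u : Quaternion ℝ, ‖u‖ = 1 ∧ ‖q‖ • u = q := by
  rcases eq_or_ne q 0 with rfl | hq
  · exact ⟨1, norm_one, by simp⟩
  · have hn : ‖q‖ ≠ 0 := norm_ne_zero_iff.2 hq
    exact ⟨‖q‖⁻¹ • q, by simp [norm_smul, hn], smul_inv_smul₀ hn q⟩

/-- Scalars can be pulled out of an ordered product in an algebra. -/
theorem List.prod_ofFn_smul {R A : Type*} [CommSemiring R] [Semiring A] [Algebra R A] {n : ℕ}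
    (r : Fin n → R) (g : Fin n → A) :
    (List.ofFn fun i => r i • g i).prod = (∏ i, r i) • (List.ofFn g).prod := by
  induction n with
  | zero => simp
  | succ n ih =>
    simp only [List.ofFn_succ, List.prod_cons, ih, Fin.prod_univ_succ, smul_mul_smul_comm]

/-- for every unit vector `(t₁, …, t_k, t)` of
`ℝ^{m₁-3} × ⋯ × ℝ^{m_k-3} × ℍ ≅ ℝ^{m+1}` there are a point `((x₁,q₁),…,(x_k,q_k))` of
`S^{m₁} × ⋯ × S^{m_k}` and a real `μ > 0` with `(x₁, …, x_k, q₁q₂⋯q_k) = μ • (t₁, …, t_k, t)`;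
i.e. the normalized map `((x₁,q₁),…,(x_k,q_k)) ↦ (x₁,…,x_k,q₁⋯q_k)/|(x₁,…,x_k,q₁⋯q_k)|` is
surjective onto the unit sphere `S^m`. -/
theorem stmt8 (k : ℕ) (hk : 2 ≤ k) (m : Fin k → ℕ) (hm : ∀ i, 4 ≤ m i)
    (t : ∀ i : Fin k, EuclideanSpace ℝ (Fin (m i - 3))) (t' : Quaternion ℝ)
    (hunit : (∑ i, ‖t i‖ ^ 2) + ‖t'‖ ^ 2 = 1) :
    ∃ (a : ∀ i : Fin k, SpSphere (m i - 3)) (μ : ℝ), 0 < μ ∧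
      (∀ i, (a i).1.1 = μ • t i) ∧
      (List.ofFn fun i => (a i).1.2).prod = μ • t' := by
  obtain ⟨n, rfl⟩ : ∃ n, k = n + 1 := ⟨k - 1, by omega⟩
  obtain ⟨μ, hμ, hle, hprod⟩ := exists_pos_prod_sqrt_eq_mul (fun i => ‖t i‖)
    (fun i => norm_nonneg _) (norm_nonneg t') hunit
  obtain ⟨u, hu, hut⟩ := Quaternion.exists_norm_eq_one_smul t'
  let g : Fin (n + 1) → Quaternion ℝ := Fin.cons u fun _ => 1
  have hg : ∀ i, ‖g i‖ = 1 := Fin.cases hu fun _ => norm_one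
  refine ⟨fun i => ⟨(μ • t i, √(1 - (μ * ‖t i‖) ^ 2) • g i), ?_⟩, μ, hμ, fun i => rfl, ?_⟩
  · simp only [norm_smul, hg, mul_one, Real.norm_eq_abs, abs_of_pos hμ, sq_abs]
    rw [Real.sq_sqrt (sub_nonneg.2 (hle i))]
    ring
  · rw [List.prod_ofFn_smul, hprod, mul_smul]
    simp [g, List.ofFn_succ, hut]
end
end

section
/- Let k ≥ 1. The map φ from the cube [0,1]^k to ℝ^{k+1} defined by φ(t₁,…,t_k) = ((1−t₁)/A, (1−t₂)/A, …, (1−t_k)/A, (t₁t₂⋯t_k)/A), where A = t₁t₂⋯t_k + Σ_{i=1}^{k}(1−t_i), is well defined (A > 0 for every (t₁,…,t_k) ∈ [0,1]^k) and is a homeomorphism of [0,1]^k onto the standard k-dimensional simplex Δ^k = {(s₁,…,s_{k+1}) ∈ ℝ^{k+1} : s_j ≥ 0 for all j, s₁ + ⋯ + s_{k+1} = 1}. -/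
open scoped BigOperators

noncomputable section

open Set

/-- The denominator `A = t₁⋯t_k + Σᵢ(1-tᵢ)` is positive on the cube. -/
theorem prod_add_sum_one_sub_pos {k : ℕ} {t : Fin k → ℝ} (ht : ∀ i, t i ∈ Icc (0 : ℝ) 1) :
    0 < (∏ i, t i) + ∑ i, (1 - t i) := by
  have hs : ∀ i ∈ Finset.univ, 0 ≤ 1 - t i := fun i _ => sub_nonneg.2 (ht i).2
  have hprod : 0 ≤ ∏ i, t i := Finset.prod_nonneg fun i _ => (ht i).1
  rcases (Finset.sum_nonneg hs).eq_or_lt with h | h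
  · have h1 : ∀ i, t i = 1 := fun i => by
      linarith [(Finset.sum_eq_zero_iff_of_nonneg hs).1 h.symm i (Finset.mem_univ i)]
    simp [h1]
  · linarith

/-- The equation `∏ᵢ (1 - a xᵢ) = a c` has at most one solution `a > 0` with all `a xᵢ ≤ 1`. -/
theorem le_of_prod_one_sub_mul_eq {ι : Type*} [Fintype ι] {x : ι → ℝ} {c a b : ℝ}
    (hx : ∀ i, 0 ≤ x i) (hc : 0 ≤ c) (hb : ∀ i, b * x i ≤ 1)
    (ha_eq : ∏ i, (1 - a * x i) = a * c) (hb_eq : ∏ i, (1 - b * x i) = b * c) : b ≤ a := by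
  by_contra! hab
  have hle : b * c ≤ a * c := by
    rw [← ha_eq, ← hb_eq]
    refine Finset.prod_le_prod (fun i _ => by linarith [hb i]) fun i _ => ?_
    linarith [mul_le_mul_of_nonneg_right hab.le (hx i)]
  have hc0 : c = 0 := by nlinarith
  rw [hc0, mul_zero, Finset.prod_eq_zero_iff] at ha_eq
  obtain ⟨i, -, hi⟩ := ha_eq
  have hxi : 0 < x i := (hx i).lt_of_ne fun h => by simp [← h] at hi
  nlinarith [hb i]

/-- The equation `∏ᵢ (1 - a xᵢ) = a c` has a solution `a > 0` with all `a xᵢ ≤ 1`. -/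
theorem exists_prod_one_sub_mul_eq {ι : Type*} [Fintype ι] {x : ι → ℝ} {c : ℝ}
    (hx : ∀ i, 0 ≤ x i) (hc : 0 ≤ c) (hsum : ∑ i, x i + c = 1) :
    ∃ a, 0 < a ∧ (∀ i, a * x i ≤ 1) ∧ ∏ i, (1 - a * x i) = a * c := by
  by_cases h0 : ∀ i, x i = 0
  · refine ⟨1, one_pos, by simp [h0], ?_⟩
    simp only [h0, Finset.sum_const_zero, zero_add] at hsum
    simp [h0, hsum]
  push Not at h0
  obtain ⟨i₀, hi₀⟩ := h0
  have : Nonempty ι := ⟨i₀⟩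
  obtain ⟨j, hj⟩ := Finite.exists_max x
  have hxj : 0 < x j := ((hx i₀).lt_of_ne hi₀.symm).trans_le (hj i₀)
  have hcont : ContinuousOn (fun a : ℝ => ∏ i, (1 - a * x i) - a * c) (Icc 0 (x j)⁻¹) := by
    fun_prop
  have hend : ∏ i, (1 - (x j)⁻¹ * x i) = 0 :=
    Finset.prod_eq_zero (Finset.mem_univ j) (by rw [inv_mul_cancel₀ hxj.ne', sub_self])
  have hmem : (0 : ℝ) ∈ Icc (∏ i, (1 - (x j)⁻¹ * x i) - (x j)⁻¹ * c)
      (∏ i, (1 - 0 * x i) - 0 * c) := by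
    rw [hend]
    constructor
    · have : 0 ≤ (x j)⁻¹ * c := by positivity
      linarith
    · simp
  obtain ⟨a, ⟨ha0, ha1⟩, ha⟩ := intermediate_value_Icc' (inv_nonneg.2 hxj.le) hcont hmem
  refine ⟨a, ha0.lt_of_ne ?_, fun i => ?_, sub_eq_zero.1 ha⟩
  · rintro rfl
    simp at ha
  · calc a * x i ≤ (x j)⁻¹ * x j := mul_le_mul ha1 (hj i) (hx i) (inv_nonneg.2 hxj.le)
      _ = 1 := inv_mul_cancel₀ hxj.ne'

/-- The map `φ` from the cube to the standard simplex. -/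
def cubeToSimplex (k : ℕ) (t : {t : Fin k → ℝ // ∀ i, t i ∈ Icc (0 : ℝ) 1}) :
    {s : Fin (k + 1) → ℝ // (∀ j, 0 ≤ s j) ∧ ∑ j, s j = 1} :=
  ⟨Fin.snoc (fun i => (1 - t.1 i) / ((∏ i, t.1 i) + ∑ i, (1 - t.1 i)))
      ((∏ i, t.1 i) / ((∏ i, t.1 i) + ∑ i, (1 - t.1 i))), by
    have hA := prod_add_sum_one_sub_pos t.2
    constructor
    · intro j
      refine Fin.lastCases ?_ (fun i => ?_) j
      · rw [Fin.snoc_last]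
        exact div_nonneg (Finset.prod_nonneg fun i _ => (t.2 i).1) hA.le
      · rw [Fin.snoc_castSucc]
        exact div_nonneg (sub_nonneg.2 (t.2 i).2) hA.le
    · simp only [Fin.sum_univ_castSucc, Fin.snoc_castSucc, Fin.snoc_last]
      rw [← Finset.sum_div, ← add_div, add_comm, div_self hA.ne']⟩

theorem continuous_cubeToSimplex (k : ℕ) : Continuous (cubeToSimplex k) := by
  have hcoord : ∀ i, Continuous fun t : {t : Fin k → ℝ // ∀ i, t i ∈ Icc (0 : ℝ) 1} => t.1 i :=
    fun i => (continuous_apply i).comp continuous_subtype_val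
  have hprod := continuous_finsetProd Finset.univ fun i _ => hcoord i
  have hA := hprod.add
    (continuous_finsetSum Finset.univ fun i _ => continuous_const (y := (1 : ℝ)).sub (hcoord i))
  refine Continuous.subtype_mk (continuous_pi fun j => ?_) _
  refine Fin.lastCases ?_ (fun i => ?_) j
  · simp only [Fin.snoc_last]
    exact hprod.div hA fun t => (prod_add_sum_one_sub_pos t.2).ne'
  · simp only [Fin.snoc_castSucc]
    exact (continuous_const.sub (hcoord i)).div hA fun t => (prod_add_sum_one_sub_pos t.2).ne'

theorem injective_cubeToSimplex (k : ℕ) : Function.Injective (cubeToSimplex k) := by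
  intro t u htu
  have key : ∀ v, (∀ i, v.1 i = 1 - ((∏ i, v.1 i) + ∑ i, (1 - v.1 i)) *
      (cubeToSimplex k v).1 i.castSucc) ∧
      ∏ i, v.1 i = ((∏ i, v.1 i) + ∑ i, (1 - v.1 i)) * (cubeToSimplex k v).1 (Fin.last k) := by
    intro v
    have hA := (prod_add_sum_one_sub_pos v.2).ne'
    simp only [cubeToSimplex, Fin.snoc_castSucc, Fin.snoc_last]
    exact ⟨fun i => by rw [mul_div_cancel₀ _ hA, sub_sub_cancel], by rw [mul_div_cancel₀ _ hA]⟩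
  obtain ⟨ht, htp⟩ := key t
  obtain ⟨hu, hup⟩ := key u
  rw [htu] at ht htp
  set s := cubeToSimplex k u
  set a := (∏ i, t.1 i) + ∑ i, (1 - t.1 i)
  set b := (∏ i, u.1 i) + ∑ i, (1 - u.1 i)
  rw [Finset.prod_congr rfl fun i _ => ht i] at htp
  rw [Finset.prod_congr rfl fun i _ => hu i] at hup
  have hab : a = b := le_antisymm
    (le_of_prod_one_sub_mul_eq (x := fun i : Fin k => s.1 i.castSucc)
      (fun i => s.2.1 i.castSucc) (s.2.1 _)
      (fun i => by linarith [ht i, (t.2 i).1]) hup htp)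
    (le_of_prod_one_sub_mul_eq (x := fun i : Fin k => s.1 i.castSucc)
      (fun i => s.2.1 i.castSucc) (s.2.1 _)
      (fun i => by linarith [hu i, (u.2 i).1]) htp hup)
  exact Subtype.ext (funext fun i => by rw [ht i, hu i, hab])

theorem surjective_cubeToSimplex (k : ℕ) : Function.Surjective (cubeToSimplex k) := by
  rintro ⟨s, hs, hsum⟩
  rw [Fin.sum_univ_castSucc] at hsum
  obtain ⟨a, ha, hle, heq⟩ :=
    exists_prod_one_sub_mul_eq (fun i : Fin k => hs i.castSucc) (hs (Fin.last k)) hsum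
  refine ⟨⟨fun i => 1 - a * s i.castSucc, fun i => ⟨by linarith [hle i], ?_⟩⟩, ?_⟩
  · linarith [mul_nonneg ha.le (hs i.castSucc)]
  have hA : (∏ i : Fin k, (1 - a * s i.castSucc)) + ∑ i : Fin k, (1 - (1 - a * s i.castSucc))
      = a := by
    simp only [sub_sub_cancel]
    rw [heq, ← Finset.mul_sum, ← mul_add, add_comm, hsum, mul_one]
  refine Subtype.ext (funext fun j => ?_)
  simp only [cubeToSimplex, hA]
  refine Fin.lastCases ?_ (fun i => ?_) j
  · rw [Fin.snoc_last, heq, mul_div_cancel_left₀ _ ha.ne']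
  · rw [Fin.snoc_castSucc, sub_sub_cancel, mul_div_cancel_left₀ _ ha.ne']

/-- for `k ≥ 1`, the quantity `A = t₁⋯t_k + Σᵢ(1-tᵢ)` is positive on the cube
`[0,1]^k`, and the map `φ(t₁,…,t_k) = ((1-t₁)/A, …, (1-t_k)/A, (t₁⋯t_k)/A)` is a
homeomorphism of the cube `[0,1]^k` onto the standard `k`-simplex
`Δ^k = {s ∈ ℝ^{k+1} : s_j ≥ 0, Σ s_j = 1}`. -/
theorem stmt11 (k : ℕ) (hk : 1 ≤ k) :
    (∀ t : Fin k → ℝ, (∀ i, t i ∈ Set.Icc (0 : ℝ) 1) →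
      0 < (∏ i, t i) + ∑ i, (1 - t i)) ∧
    ∃ h : {t : Fin k → ℝ // ∀ i, t i ∈ Set.Icc (0 : ℝ) 1} ≃ₜ
        {s : Fin (k + 1) → ℝ // (∀ j, 0 ≤ s j) ∧ ∑ j, s j = 1},
      ∀ t : {t : Fin k → ℝ // ∀ i, t i ∈ Set.Icc (0 : ℝ) 1},
        (h t : Fin (k + 1) → ℝ) =
          Fin.snoc (fun i => (1 - t.1 i) / ((∏ i, t.1 i) + ∑ i, (1 - t.1 i)))
            ((∏ i, t.1 i) / ((∏ i, t.1 i) + ∑ i, (1 - t.1 i))) := by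
  refine ⟨fun t ht => prod_add_sum_one_sub_pos ht, ?_⟩
  have hcube : IsCompact {t : Fin k → ℝ | ∀ i, t i ∈ Set.Icc (0 : ℝ) 1} :=
    isCompact_pi_infinite fun _ => isCompact_Icc
  have : CompactSpace {t : Fin k → ℝ // ∀ i, t i ∈ Set.Icc (0 : ℝ) 1} :=
    isCompact_iff_compactSpace.1 hcube
  exact ⟨(isHomeomorph_iff_continuous_bijective.2 ⟨continuous_cubeToSimplex k,
    injective_cubeToSimplex k, surjective_cubeToSimplex k⟩).homeomorph, fun _ => rfl⟩
end
end

section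
/- Let k ≥ 2. Consider the action of the group {±1}^{k−1} on ℝ^k in which (g₁,…,g_{k−1}) sends (q₁,…,q_k) to (q₁g₁⁻¹, g₁q₂g₂⁻¹, …, g_{k−2}q_{k−1}g_{k−1}⁻¹, g_{k−1}q_k). Then the orbit space ℝ^k/{±1}^{k−1} is homeomorphic to ℝ^k. -/
noncomputable section

/-- The orbit relation of the chain action of the norm-one elements `S(𝕂)^{k-1}` on `𝕂^k`,
where `(g₁,…,g_{k-1})` sends `(q₁,…,q_k)` to `(q₁g₁⁻¹, g₁q₂g₂⁻¹, …, g_{k-1}q_k)`. -/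
def chainRel (K : Type*) [DivisionRing K] [Norm K] (k : ℕ) (a b : Fin k → K) : Prop :=
  ∃ g : Fin (k - 1) → K, (∀ j, ‖g j‖ = 1) ∧
    ∀ i : Fin k, b i = chainExt k g (i : ℕ) * a i * (chainExt k g ((i : ℕ) + 1))⁻¹

open Finset

section CoordMin

variable {ι : Type*} [Fintype ι] [Nonempty ι]

/-- The smallest coordinate of a real vector. -/
def coordMin (x : ι → ℝ) : ℝ := univ.inf' univ_nonempty x

theorem coordMin_le (x : ι → ℝ) (i : ι) : coordMin x ≤ x i :=
  inf'_le _ (mem_univ i)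

theorem exists_coordMin_eq (x : ι → ℝ) : ∃ i, coordMin x = x i := by
  obtain ⟨i, -, hi⟩ := exists_mem_eq_inf' (univ_nonempty (α := ι)) x
  exact ⟨i, hi⟩

theorem coordMin_add_const (x : ι → ℝ) (c : ℝ) :
    coordMin (fun i => x i + c) = coordMin x + c := by
  obtain ⟨i, hi⟩ := exists_coordMin_eq x
  obtain ⟨j, hj⟩ := exists_coordMin_eq (fun i => x i + c)
  have h₁ := coordMin_le x j
  have h₂ := coordMin_le (fun i => x i + c) i
  linarith

theorem continuous_coordMin : Continuous (coordMin : (ι → ℝ) → ℝ) :=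
  Continuous.finset_inf'_apply _ fun i _ => continuous_apply i

theorem coordMin_abs_nonneg (a : ι → ℝ) : 0 ≤ coordMin fun i => |a i| := by
  obtain ⟨i, hi⟩ := exists_coordMin_eq fun i => |a i|
  rw [hi]
  exact abs_nonneg _

theorem coordMin_abs_eq_zero {a : ι → ℝ} (h : ∏ i, a i = 0) :
    (coordMin fun i => |a i|) = 0 := by
  obtain ⟨i, -, hi⟩ := prod_eq_zero_iff.1 h
  refine le_antisymm ((coordMin_le _ i).trans ?_) (coordMin_abs_nonneg a)
  simp [hi]

theorem coordMin_abs_pos {a : ι → ℝ} (h : ∏ i, a i ≠ 0) :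
    0 < coordMin fun i => |a i| := by
  obtain ⟨i, hi⟩ := exists_coordMin_eq fun i => |a i|
  rw [hi]
  exact abs_pos.2 (prod_ne_zero_iff.1 h i (mem_univ i))

/-- The absolute values of the coordinates, shifted along the diagonal so that the smallest one
acquires the sign of the product of the coordinates. -/
def signedAbs (a : ι → ℝ) (i : ι) : ℝ :=
  |a i| - (coordMin fun j => |a j|) +
    if 0 ≤ ∏ j, a j then coordMin fun j => |a j| else -coordMin fun j => |a j|

theorem signedAbs_of_nonneg {a : ι → ℝ} (h : 0 ≤ ∏ j, a j) :
    signedAbs a = fun i => |a i| := by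
  ext i
  simp [signedAbs, h]

theorem signedAbs_of_neg {a : ι → ℝ} (h : ∏ j, a j < 0) :
    signedAbs a = fun i => |a i| + -2 * coordMin fun j => |a j| := by
  ext i
  rw [signedAbs, if_neg h.not_ge]
  ring

theorem continuous_signedAbs : Continuous (signedAbs : (ι → ℝ) → ι → ℝ) := by
  have hm : Continuous fun a : ι → ℝ => coordMin fun j => |a j| :=
    continuous_coordMin.comp (by fun_prop)
  refine continuous_pi fun i => (Continuous.sub (by fun_prop) hm).add ?_
  refine hm.if_le hm.neg continuous_const (by fun_prop) fun a ha => ?_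
  rw [coordMin_abs_eq_zero ha.symm, neg_zero]

end CoordMin

/-- Negation of a single coordinate. -/
def negAt {ι : Type*} [DecidableEq ι] (i₀ : ι) (x : ι → ℝ) : ι → ℝ :=
  Function.update x i₀ (-x i₀)

section NegAt

variable {ι : Type*} [DecidableEq ι] (i₀ : ι)

theorem abs_negAt (x : ι → ℝ) (i : ι) : |negAt i₀ x i| = |x i| := by
  by_cases h : i = i₀
  · subst h
    simp [negAt]
  · simp [negAt, h]

theorem prod_negAt [Fintype ι] (x : ι → ℝ) : ∏ i, negAt i₀ x i = -∏ i, x i := by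
  rw [negAt, prod_update_of_mem (mem_univ i₀), ← mul_prod_erase univ x (mem_univ i₀),
    sdiff_singleton_eq_erase, neg_mul]

theorem continuous_negAt : Continuous (negAt i₀) :=
  continuous_id.update i₀ (continuous_apply i₀).neg

end NegAt

theorem prod_range_mul_inv_succ {G : Type*} [CommGroupWithZero G] {e : ℕ → G}
    (he : ∀ j, e j ≠ 0) (n : ℕ) :
    ∏ j ∈ range n, e j * (e (j + 1))⁻¹ = e 0 * (e n)⁻¹ := by
  induction n with
  | zero => simp [he 0]
  | succ n ih =>
    rw [prod_range_succ, ih]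
    have := he n
    field_simp

theorem norm_chainExt_s12 {K : Type*} [NormedDivisionRing K] (k : ℕ) {g : Fin (k - 1) → K}
    (hg : ∀ j, ‖g j‖ = 1) (j : ℕ) : ‖chainExt k g j‖ = 1 := by
  unfold chainExt
  split_ifs
  · exact hg _
  · exact norm_one

theorem chainRel.abs_eq {k : ℕ} {a b : Fin k → ℝ} (h : chainRel ℝ k a b) (i : Fin k) :
    |b i| = |a i| := by
  obtain ⟨g, hg, h⟩ := h
  have hn (j : ℕ) : |chainExt k g j| = 1 := norm_chainExt_s12 k hg j
  rw [h i, abs_mul, abs_mul, abs_inv, hn, hn]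
  simp

theorem chainRel.prod_eq {k : ℕ} {a b : Fin k → ℝ} (h : chainRel ℝ k a b) :
    ∏ i, b i = ∏ i, a i := by
  obtain ⟨g, hg, h⟩ := h
  have hne (j : ℕ) : chainExt k g j ≠ 0 := by
    rw [← norm_ne_zero_iff, norm_chainExt_s12 k hg j]
    exact one_ne_zero
  have h₀ : chainExt k g 0 = 1 := dif_neg (by omega)
  have hk : chainExt k g k = 1 := dif_neg (by omega)
  calc ∏ i, b i
      = ∏ i : Fin k, (chainExt k g i * (chainExt k g (i + 1))⁻¹) * a i :=
        prod_congr rfl fun i _ => by rw [h i]; ring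
    _ = ∏ i, a i := by
        rw [prod_mul_distrib,
          Fin.prod_univ_eq_prod_range (fun j => chainExt k g j * (chainExt k g (j + 1))⁻¹) k,
          prod_range_mul_inv_succ hne, h₀, hk]
        simp

theorem chainRel_of_signs {k : ℕ} {a b s : Fin k → ℝ} (hs : ∀ i, |s i| = 1)
    (hprod : ∏ i, s i = 1) (h : ∀ i, b i = s i * a i) : chainRel ℝ k a b := by
  set t : ℕ → ℝ := fun i => if h : i < k then s ⟨i, h⟩ else 1 with ht
  have htn (i : ℕ) : |t i| = 1 := by
    simp only [ht]
    split_ifs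
    · exact hs _
    · exact abs_one
  have hts (i : Fin k) : t i = s i := by simp [ht]
  set e : ℕ → ℝ := fun j => ∏ i ∈ range j, t i with he
  have hen (j : ℕ) : |e j| = 1 := by simp [he, abs_prod, htn]
  have hek : e k = 1 := by
    rw [he]
    simp only
    rw [← Fin.prod_univ_eq_prod_range, ← hprod]
    exact prod_congr rfl fun i _ => hts i
  have hext (j : ℕ) (hj : j ≤ k) : chainExt k (fun i : Fin (k - 1) => e (i + 1)) j = e j := by
    unfold chainExt
    split_ifs with hj'
    · simp [Nat.sub_add_cancel hj'.1]
    · obtain rfl | rfl : j = 0 ∨ j = k := by omega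
      · simp [he]
      · exact hek.symm
  refine ⟨fun i => e (i + 1), fun j => hen _, fun i => ?_⟩
  have hsucc : e (i + 1) = e i * s i := by
    simp only [he, prod_range_succ, hts]
  rw [hext _ i.2.le, hext _ i.2, hsucc, h i]
  have he₀ : e i ≠ 0 := abs_pos.1 (by rw [hen]; exact one_pos)
  have hs₀ : s i ≠ 0 := abs_pos.1 (by rw [hs]; exact one_pos)
  have hs₂ : s i ^ 2 = 1 := by rw [← sq_abs, hs, one_pow]
  field_simp
  rw [hs₂, one_mul]

theorem chainRel_of_abs_eq_of_prod_eq {k : ℕ} {a b : Fin k → ℝ} (habs : ∀ i, |b i| = |a i|)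
    (hprod : ∏ i, b i = ∏ i, a i) : chainRel ℝ k a b := by
  have hsign (i : Fin k) : ∃ s : ℝ, |s| = 1 ∧ b i = s * a i := by
    rcases abs_eq_abs.1 (habs i) with h | h
    · exact ⟨1, by simp, by simp [h]⟩
    · exact ⟨-1, by simp, by simp [h]⟩
  choose s hs h using hsign
  have hs₁ : |∏ i, s i| = 1 := by simp [abs_prod, hs]
  rcases (abs_eq zero_le_one).1 hs₁ with h₁ | h₁
  · exact chainRel_of_signs hs h₁ h
  · have h₀ : ∏ i, a i = 0 := by
      simp only [h, prod_mul_distrib, h₁] at hprod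
      linarith
    obtain ⟨j, -, hj⟩ := prod_eq_zero_iff.1 h₀
    refine chainRel_of_signs (s := negAt j s) (fun i => by rw [abs_negAt, hs])
      (by rw [prod_negAt, h₁, neg_neg]) fun i => ?_
    by_cases hij : i = j
    · subst hij
      simp [h i, hj]
    · simp [negAt, hij, h i]

/-- The orbit space of the chain action of `{±1}^{k-1}` on `ℝ^k` is homeomorphic to `ℝ^k`, by
the map induced by `signedAbs`. -/
def chainQuotHomeomorph (k : ℕ) [NeZero k] : Quot (chainRel ℝ k) ≃ₜ (Fin k → ℝ) where
  toFun := Quot.lift signedAbs fun a b h => by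
    ext i
    simp only [signedAbs, h.abs_eq, h.prod_eq]
  invFun y := if 0 ≤ coordMin y then Quot.mk _ y
    else Quot.mk _ (negAt 0 fun i => y i + -2 * coordMin y)
  left_inv := by
    rintro ⟨a⟩
    simp only
    rcases le_or_gt 0 (∏ i, a i) with h | h
    · rw [signedAbs_of_nonneg h, if_pos (coordMin_abs_nonneg a)]
      refine Quot.sound (chainRel_of_abs_eq_of_prod_eq (fun i => (abs_abs _).symm) ?_)
      rw [← abs_prod, abs_of_nonneg h]
    · have hpos := coordMin_abs_pos h.ne
      rw [signedAbs_of_neg h, coordMin_add_const, if_neg (by linarith)]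
      refine Quot.sound (chainRel_of_abs_eq_of_prod_eq (fun i => ?_) ?_)
      · rw [abs_negAt, ← abs_abs (a i)]
        congr 1
        ring
      · rw [prod_negAt, ← neg_neg (∏ i, a i), ← abs_of_neg h, abs_prod]
        congr 1
        exact prod_congr rfl fun i _ => by ring
  right_inv y := by
    simp only
    split_ifs with h
    · have hy (i : Fin k) : 0 ≤ y i := h.trans (coordMin_le y i)
      simp only [signedAbs_of_nonneg (prod_nonneg fun i _ => hy i), abs_of_nonneg (hy _)]
    · have hy (i : Fin k) : 0 < y i + -2 * coordMin y := by
        linarith [coordMin_le y i]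
      have hneg : ∏ i, negAt 0 (fun i => y i + -2 * coordMin y) i < 0 := by
        rw [prod_negAt]
        exact neg_neg_of_pos (prod_pos fun i _ => hy i)
      simp only [signedAbs_of_neg hneg, abs_negAt, abs_of_pos (hy _), coordMin_add_const]
      ext i
      ring
  continuous_toFun := continuous_quot_lift _ continuous_signedAbs
  continuous_invFun := by
    have hm : Continuous (coordMin : (Fin k → ℝ) → ℝ) := continuous_coordMin
    refine continuous_quot_mk.if_le (continuous_quot_mk.comp ((continuous_negAt 0).comp
      (continuous_pi fun i => (continuous_apply i).add (continuous_const.mul hm))))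
      continuous_const hm fun y hy => ?_
    refine Quot.sound (chainRel_of_abs_eq_of_prod_eq (fun i => ?_) ?_)
    · simp [abs_negAt, ← hy]
    · obtain ⟨j, hj⟩ := exists_coordMin_eq y
      have h₀ : ∏ i, y i = 0 := prod_eq_zero (mem_univ j) (hj.symm.trans hy.symm)
      simp [prod_negAt, ← hy, h₀]

/-- for `k ≥ 2`, the orbit space `ℝ^k/{±1}^{k-1}` of the chain action of
`{±1}^{k-1}` (the real numbers of norm `1`) on `ℝ^k` is homeomorphic to `ℝ^k`. -/
theorem stmt12 (k : ℕ) (hk : 2 ≤ k) :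
    Nonempty (Quot (chainRel ℝ k) ≃ₜ EuclideanSpace ℝ (Fin k)) := by
  have : NeZero k := ⟨by omega⟩
  exact ⟨(chainQuotHomeomorph k).trans (EuclideanSpace.equiv (Fin k) ℝ).toHomeomorph.symm⟩
end
end
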